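/- Assume additionally that (λ_k) converges to 0 and that Γ is uniformly asymptotically regular: for every h ∈ J, sup_{y ∈ C} ‖T_t y − T_h (T_t y)‖ → 0 as t → ∞ along J. Then the Browder sequence (x^k) converges strongly (in norm) to a point y ∈ Fix(Γ) with x⁰ ⪯ y. Moreover, if q ∈ Fix(Γ) and there is a subsequence (x^{k_i}) of (x^k) with x^{k_i} ⪯ q for all i, then ‖x⁰ − y‖ ≤ ‖x⁰ − q‖. -/

import Mathlib

open Filter Topology RealInnerProductSpace

/-- Bounded families in a Hilbert space converge weakly along ultrafilters. -/
theorem exists_weak_limit_of_norm_le {ι H : Type*} [NormedAddCommGroup H]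
    [InnerProductSpace ℝ H] [CompleteSpace H] (U : Ultrafilter ι) {x : ι → H} {R : ℝ}
    (hR : ∀ i, ‖x i‖ ≤ R) :
    ∃ y : H, ∀ f : H →L[ℝ] ℝ, Tendsto (fun i => f (x i)) U (𝓝 (f y)) := by
  have hcomp := WeakDual.isCompact_closedBall (𝕜 := ℝ) (E := H) 0 R
  let g : ι → WeakDual ℝ H :=
    fun i => StrongDual.toWeakDual (InnerProductSpace.toDual ℝ H (x i))
  have hg : ∀ i, g i ∈ WeakDual.toStrongDual ⁻¹' Metric.closedBall (0 : StrongDual ℝ H) R := by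
    intro i
    have : ‖InnerProductSpace.toDual ℝ H (x i)‖ ≤ R := by simpa using hR i
    simpa [g] using this
  obtain ⟨w, -, hw⟩ := hcomp.ultrafilter_le_nhds (U.map g)
    (tendsto_principal.2 (Eventually.of_forall hg))
  refine ⟨(InnerProductSpace.toDual ℝ H).symm (WeakDual.toStrongDual w), fun f => ?_⟩
  have hw' : Tendsto g U (𝓝 w) := hw
  have h := ((WeakDual.eval_continuous ((InnerProductSpace.toDual ℝ H).symm f)).tendsto w).comp hw'
  have e1 : ∀ z : H, f z = ⟪z, (InnerProductSpace.toDual ℝ H).symm f⟫ := by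
    intro z
    rw [real_inner_comm, InnerProductSpace.toDual_symm_apply]
  have e2 : w ((InnerProductSpace.toDual ℝ H).symm f) =
      f ((InnerProductSpace.toDual ℝ H).symm (WeakDual.toStrongDual w)) := by
    rw [e1, InnerProductSpace.toDual_symm_apply]
    rfl
  rw [e2] at h
  refine h.congr fun i => ?_
  rw [e1]
  rfl

/-- Closed convex sets are stable under weak limits. -/
theorem IsClosed.mem_of_weak_limit {ι E : Type*} [NormedAddCommGroup E] [NormedSpace ℝ E]
    {l : Filter ι} [l.NeBot] {x : ι → E} {y : E}
    (hy : ∀ f : E →L[ℝ] ℝ, Tendsto (fun i => f (x i)) l (𝓝 (f y)))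
    {s : Set E} (hs : IsClosed s) (hconv : Convex ℝ s) (hmem : ∀ᶠ i in l, x i ∈ s) : y ∈ s := by
  by_contra hys
  obtain ⟨f, u, hfu, huy⟩ := geometric_hahn_banach_closed_point hconv hs hys
  exact absurd (le_of_tendsto (hy f) (hmem.mono fun i hi => (hfu _ hi).le)) (not_le.2 huy)

theorem tendsto_inner_sub_of_weak_limit {ι H : Type*} [NormedAddCommGroup H]
    [InnerProductSpace ℝ H] {l : Filter ι} {x : ι → H} {y : H}
    (hy : ∀ f : H →L[ℝ] ℝ, Tendsto (fun i => f (x i)) l (𝓝 (f y))) (v : H) :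
    Tendsto (fun i => ⟪v, x i - y⟫) l (𝓝 0) := by
  have h := (hy (innerSL ℝ v)).sub_const ⟪v, y⟫
  simpa [inner_sub_right] using h

/-- The map `F` averaged with the constant map `x0`, which has weight `l`. -/
def anchoredMap {H : Type*} [NormedAddCommGroup H] [InnerProductSpace ℝ H]
    (F : H → H) (l : ℝ) (x0 z : H) : H :=
  (1 - l) • F z + l • x0

theorem add_mem_of_convex_of_smul_mem {H : Type*} [NormedAddCommGroup H] [InnerProductSpace ℝ H]
    {K : Set H} (hKconvex : Convex ℝ K)
    (hKcone : ∀ (α : ℝ), 0 ≤ α → ∀ x ∈ K, α • x ∈ K) {a b : H} (ha : a ∈ K) (hb : b ∈ K) :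
    a + b ∈ K := by
  have h := hKcone 2 (by norm_num) _
    (hKconvex ha hb (a := 1 / 2) (b := 1 / 2) (by norm_num) (by norm_num) (by norm_num))
  convert h using 1
  module

section AnchoredMap

variable {H : Type*} [NormedAddCommGroup H] [InnerProductSpace ℝ H]
  {K C : Set H} {F : H → H} {l : ℝ} {x0 : H}

theorem norm_sq_sub_le_inner_of_anchored (hl : 0 < l) {p q : H}
    (hp : anchoredMap F l x0 p = p) (hq : F q = q) (hl1 : l < 1)
    (hF : ‖F p - F q‖ ≤ ‖p - q‖) : ‖p - q‖ ^ 2 ≤ ⟪x0 - q, p - q⟫ := by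
  have e : p - q = (1 - l) • (F p - F q) + l • (x0 - q) := by
    rw [hq]
    nth_rewrite 1 [← hp]
    unfold anchoredMap
    module
  have h1 : ⟪p - q, p - q⟫ =
      (1 - l) * ⟪F p - F q, p - q⟫ + l * ⟪x0 - q, p - q⟫ := by
    nth_rewrite 1 [e]
    rw [inner_add_left, real_inner_smul_left, real_inner_smul_left]
  rw [real_inner_self_eq_norm_sq] at h1
  have h2 : ⟪F p - F q, p - q⟫ ≤ ‖p - q‖ ^ 2 :=
    (real_inner_le_norm _ _).trans (by nlinarith [norm_nonneg (p - q)])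
  have h3 := mul_le_mul_of_nonneg_left h2 (sub_pos.2 hl1).le
  have h4 : l * ‖p - q‖ ^ 2 ≤ l * ⟪x0 - q, p - q⟫ := by linarith
  exact le_of_mul_le_mul_left h4 hl

variable (hKadd : ∀ a ∈ K, ∀ b ∈ K, a + b ∈ K)
  (hKcone : ∀ (α : ℝ), 0 ≤ α → ∀ x ∈ K, α • x ∈ K)
  (hCconvex : Convex ℝ C) (hFself : ∀ z ∈ C, F z ∈ C)
  (hFmono : ∀ z ∈ C, ∀ w ∈ C, w - z ∈ K → F w - F z ∈ K)
  (hx0 : x0 ∈ C) (hx0le : F x0 - x0 ∈ K) (hl : l ∈ Set.Ioo (0 : ℝ) 1)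

include hCconvex hFself hx0 hl in
theorem anchoredMap_mem {z : H} (hz : z ∈ C) : anchoredMap F l x0 z ∈ C :=
  hCconvex (hFself z hz) hx0 (sub_pos.2 hl.2).le hl.1.le (by ring)

omit [InnerProductSpace ℝ H] in
include hKadd hFmono hx0 hx0le in
theorem map_sub_anchor_mem {z : H} (hz : z ∈ C) (hz0 : z - x0 ∈ K) : F z - x0 ∈ K := by
  have h := hKadd _ (hFmono x0 hx0 z hz hz0) _ hx0le
  rwa [sub_add_sub_cancel] at h

include hKadd hKcone hCconvex hFself hFmono hx0 hx0le hl in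
theorem anchoredMap_iterate_mem (n : ℕ) :
    (anchoredMap F l x0)^[n] x0 ∈ C ∧ (anchoredMap F l x0)^[n] x0 - x0 ∈ K ∧
      (anchoredMap F l x0)^[n + 1] x0 - (anchoredMap F l x0)^[n] x0 ∈ K := by
  induction n with
  | zero =>
    have h0 : x0 - x0 ∈ K := by simpa using hKcone 0 le_rfl _ hx0le
    refine ⟨hx0, h0, ?_⟩
    have h := hKcone (1 - l) (sub_pos.2 hl.2).le _ hx0le
    convert h using 1
    simp only [zero_add, Function.iterate_one, Function.iterate_zero, id, anchoredMap]
    module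
  | succ n ih =>
    obtain ⟨hC, h0, hs⟩ := ih
    rw [Function.iterate_succ_apply'] at hs
    rw [Function.iterate_succ_apply' _ (n + 1), Function.iterate_succ_apply' _ n]
    set z := (anchoredMap F l x0)^[n] x0
    have hSC : anchoredMap F l x0 z ∈ C := anchoredMap_mem hCconvex hFself hx0 hl hC
    refine ⟨hSC, ?_, ?_⟩
    · have h := hKadd _ hs _ h0
      rwa [sub_add_sub_cancel] at h
    · have h := hKcone (1 - l) (sub_pos.2 hl.2).le _ (hFmono z hC _ hSC hs)
      convert h using 1
      nth_rewrite 1 [anchoredMap]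
      nth_rewrite 2 [anchoredMap]
      module

include hKadd hKcone hCconvex hFself hFmono hx0 hx0le hl in
theorem map_anchoredMap_iterate_sub_mem (n : ℕ) :
    F ((anchoredMap F l x0)^[n] x0) - (anchoredMap F l x0)^[n] x0 ∈ K := by
  obtain ⟨hC, h0, hs⟩ :=
    anchoredMap_iterate_mem hKadd hKcone hCconvex hFself hFmono hx0 hx0le hl n
  rw [Function.iterate_succ_apply'] at hs
  set z := (anchoredMap F l x0)^[n] x0
  have h := hKadd _ (hKcone l hl.1.le _ (map_sub_anchor_mem hKadd hFmono hx0 hx0le hC h0)) _ hs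
  convert h using 1
  unfold anchoredMap
  module

variable (hKclosed : IsClosed K) (hCclosed : IsClosed C)
  (hFnonexp : ∀ z ∈ C, ∀ w ∈ C, w - z ∈ K → ‖F z - F w‖ ≤ ‖z - w‖)
  {p : H} (hp : Tendsto (fun n => (anchoredMap F l x0)^[n] x0) atTop (𝓝 p))

include hKadd hKcone hCconvex hFself hFmono hx0 hx0le hl hKclosed hp in
theorem sub_anchoredMap_iterate_mem (n : ℕ) : p - (anchoredMap F l x0)^[n] x0 ∈ K := by
  refine hKclosed.mem_of_tendsto (hp.sub_const _) (eventually_atTop.2 ⟨n, fun m hm => ?_⟩)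
  induction m, hm using Nat.le_induction with
  | base => simpa using hKcone 0 le_rfl _ hx0le
  | succ m _ ih =>
    have h := hKadd _ (anchoredMap_iterate_mem hKadd hKcone hCconvex hFself hFmono
      hx0 hx0le hl m).2.2 _ ih
    rwa [sub_add_sub_cancel] at h

include hKadd hKcone hCconvex hFself hFmono hx0 hx0le hl hCclosed hp in
theorem anchoredMap_limit_mem : p ∈ C :=
  hCclosed.mem_of_tendsto hp (Eventually.of_forall fun n =>
    (anchoredMap_iterate_mem hKadd hKcone hCconvex hFself hFmono hx0 hx0le hl n).1)

include hKadd hKcone hCconvex hFself hFmono hx0 hx0le hl hKclosed hCclosed hFnonexp hp in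
theorem anchoredMap_limit_fixed : anchoredMap F l x0 p = p := by
  have hpC := anchoredMap_limit_mem hKadd hKcone hCconvex hFself hFmono hx0 hx0le hl hCclosed hp
  have hFp : Tendsto (fun n => F ((anchoredMap F l x0)^[n] x0)) atTop (𝓝 (F p)) := by
    rw [tendsto_iff_norm_sub_tendsto_zero]
    refine squeeze_zero (fun _ => norm_nonneg _) (fun n => hFnonexp _ ?_ _ hpC ?_)
      (tendsto_iff_norm_sub_tendsto_zero.1 hp)
    · exact (anchoredMap_iterate_mem hKadd hKcone hCconvex hFself hFmono hx0 hx0le hl n).1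
    · exact sub_anchoredMap_iterate_mem hKadd hKcone hCconvex hFself hFmono hx0 hx0le hl
        hKclosed hp n
  have h1 : Tendsto (fun n => (anchoredMap F l x0)^[n + 1] x0) atTop
      (𝓝 (anchoredMap F l x0 p)) := by
    simp_rw [Function.iterate_succ_apply']
    exact (hFp.const_smul (1 - l)).add_const (l • x0)
  exact tendsto_nhds_unique h1 ((tendsto_add_atTop_iff_nat 1).2 hp)

end AnchoredMap

/-- Opial-type demiclosedness along a filter: a weak limit of approximate fixed points is fixed,
provided the map does not increase the distances to the limit. -/
theorem map_eq_of_weak_limit {ι H : Type*} [NormedAddCommGroup H] [InnerProductSpace ℝ H]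
    {l : Filter ι} [l.NeBot] {x : ι → H} {F : H → H} {y : H} {R : ℝ}
    (hy : ∀ f : H →L[ℝ] ℝ, Tendsto (fun i => f (x i)) l (𝓝 (f y)))
    (hR : ∀ i, ‖x i - y‖ ≤ R) (hF : ∀ i, ‖F (x i) - F y‖ ≤ ‖x i - y‖)
    (hx : Tendsto (fun i => ‖x i - F (x i)‖) l (𝓝 0)) : F y = y := by
  have hin : Tendsto (fun i => ⟪y - F y, x i - y⟫) l (𝓝 0) :=
    tendsto_inner_sub_of_weak_limit hy _
  have hlim : Tendsto (fun i => ‖x i - F (x i)‖ ^ 2 + 2 * ‖x i - F (x i)‖ * R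
      - 2 * ⟪y - F y, x i - y⟫) l (𝓝 0) := by
    have h := ((hx.pow 2).add ((hx.const_mul 2).mul_const R)).sub (hin.const_mul 2)
    simpa using h
  have hle : ‖y - F y‖ ^ 2 ≤ 0 := by
    refine ge_of_tendsto' hlim fun i => ?_
    have h1 : ‖x i - F y‖ ≤ ‖x i - F (x i)‖ + ‖x i - y‖ :=
      (norm_sub_le_norm_sub_add_norm_sub _ (F (x i)) _).trans (by gcongr; exact hF i)
    have h2 : ‖x i - F y‖ ^ 2 =
        ‖x i - y‖ ^ 2 + 2 * ⟪y - F y, x i - y⟫ + ‖y - F y‖ ^ 2 := by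
      rw [← sub_add_sub_cancel (x i) y (F y), norm_add_sq_real, real_inner_comm]
    have h3 : ‖x i - F y‖ ^ 2 ≤ (‖x i - F (x i)‖ + ‖x i - y‖) ^ 2 := by gcongr
    nlinarith [mul_le_mul_of_nonneg_left (hR i) (norm_nonneg (x i - F (x i)))]
  have h0 : ‖y - F y‖ = 0 := by
    nlinarith [norm_nonneg (y - F y), sq_nonneg (‖y - F y‖)]
  exact (sub_eq_zero.1 (norm_eq_zero.1 h0)).symm

theorem stmt15
    {H : Type*} [NormedAddCommGroup H] [InnerProductSpace ℝ H] [CompleteSpace H]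
    (K : Set H) (hKclosed : IsClosed K) (hKconvex : Convex ℝ K)
    (hKcone : ∀ (α : ℝ), 0 ≤ α → ∀ x ∈ K, α • x ∈ K)
    (hKpointed : K ∩ (-K) = {0})
    (J : Set ℝ) (hJpos : ∀ u ∈ J, (0:ℝ) ≤ u) (hJ0 : (0:ℝ) ∈ J)
    (hJadd : ∀ u ∈ J, ∀ v ∈ J, u + v ∈ J)
    (hJunbdd : ∀ M : ℝ, ∃ u ∈ J, M < u)
    (C : Set H) (hCne : C.Nonempty) (hCbdd : Bornology.IsBounded C)
    (hCclosed : IsClosed C) (hCconvex : Convex ℝ C)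
    (T : ℝ → H → H)
    (hTself : ∀ u ∈ J, ∀ x ∈ C, T u x ∈ C)
    (hT0 : ∀ x ∈ C, T 0 x = x)
    (hTsemi : ∀ u ∈ J, ∀ v ∈ J, ∀ x ∈ C, T (u + v) x = T u (T v x))
    (hTcont : ∀ x ∈ C, ContinuousOn (fun u => T u x) J)
    (hTmono : ∀ u ∈ J, ∀ x ∈ C, ∀ y ∈ C, y - x ∈ K → T u y - T u x ∈ K)
    (hTnonexp : ∀ u ∈ J, ∀ x ∈ C, ∀ y ∈ C, (y - x ∈ K ∨ x - y ∈ K) →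
      ‖T u x - T u y‖ ≤ ‖x - y‖)
    (x0 : H) (hx0 : x0 ∈ C) (hx0le : ∀ u ∈ J, T u x0 - x0 ∈ K)
    (lam : ℕ → ℝ) (hlam : ∀ k, lam k ∈ Set.Ioo (0:ℝ) 1) (hlamanti : StrictAnti lam)
    (hlam0 : Tendsto lam atTop (𝓝 0))
    (t : ℕ → ℝ) (ht0J : t 0 ∈ J) (ht0ne : t 0 ≠ 0) (htrec : ∀ k, t (k + 1) = 2 * t k)
    (x : ℕ → H)
    (hx : ∀ k, Tendsto
      (fun n => (fun z => (1 - lam k) • T (t k) z + lam k • x0)^[n] x0)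
      atTop (𝓝 (x k)))
    (hUAR : ∀ h ∈ J, ∀ ε > 0, ∃ M : ℝ, ∀ u ∈ J, M ≤ u → ∀ y ∈ C,
      ‖T u y - T h (T u y)‖ < ε) :
    ∃ y ∈ C, (∀ u ∈ J, T u y = y) ∧ Tendsto x atTop (𝓝 y) ∧ y - x0 ∈ K ∧
      ∀ q ∈ C, (∀ u ∈ J, T u q = q) →
        ∀ ki : ℕ → ℕ, StrictMono ki → (∀ i, q - x (ki i) ∈ K) →
          ‖x0 - y‖ ≤ ‖x0 - q‖ := by
  have hKadd : ∀ a ∈ K, ∀ b ∈ K, a + b ∈ K := fun a ha b hb =>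
    add_mem_of_convex_of_smul_mem hKconvex hKcone ha hb
  have htJ : ∀ k, t k ∈ J := by
    intro k
    induction k with
    | zero => exact ht0J
    | succ k ih => rw [htrec, two_mul]; exact hJadd _ ih _ ih
  have htlim : Tendsto t atTop atTop := by
    have ht : t = fun k => t 0 * 2 ^ k := by
      funext k
      induction k with
      | zero => simp
      | succ k ih => rw [htrec, ih, pow_succ]; ring
    rw [ht]
    exact (tendsto_pow_atTop_atTop_of_one_lt one_lt_two).const_mul_atTop
      (lt_of_le_of_ne (hJpos _ ht0J) ht0ne.symm)
  have hzero : (0 : H) ∈ K := by simpa using hKcone 0 le_rfl _ (hx0le 0 hJ0)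
  have hnon : ∀ u ∈ J, ∀ z ∈ C, ∀ w ∈ C, w - z ∈ K → ‖T u z - T u w‖ ≤ ‖z - w‖ :=
    fun u hu z hz w hw h => hTnonexp u hu z hz w hw (.inl h)
  have hx' : ∀ k, Tendsto (fun n => (anchoredMap (T (t k)) (lam k) x0)^[n] x0) atTop
    (𝓝 (x k)) := hx
  have hiter := fun k => anchoredMap_iterate_mem hKadd hKcone hCconvex (hTself _ (htJ k))
    (hTmono _ (htJ k)) hx0 (hx0le _ (htJ k)) (hlam k)
  have hiterF := fun k => map_anchoredMap_iterate_sub_mem hKadd hKcone hCconvex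
    (hTself _ (htJ k)) (hTmono _ (htJ k)) hx0 (hx0le _ (htJ k)) (hlam k)
  have hxC : ∀ k, x k ∈ C := fun k => anchoredMap_limit_mem hKadd hKcone hCconvex
    (hTself _ (htJ k)) (hTmono _ (htJ k)) hx0 (hx0le _ (htJ k)) (hlam k) hCclosed (hx' k)
  have hfix : ∀ k, anchoredMap (T (t k)) (lam k) x0 (x k) = x k := fun k =>
    anchoredMap_limit_fixed hKadd hKcone hCconvex
      (hTself _ (htJ k)) (hTmono _ (htJ k)) hx0 (hx0le _ (htJ k)) (hlam k) hKclosed hCclosed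
      (hnon _ (htJ k)) (hx' k)
  have hx0x : ∀ k, x k - x0 ∈ K := fun k => sub_anchoredMap_iterate_mem hKadd hKcone hCconvex
    (hTself _ (htJ k)) (hTmono _ (htJ k)) hx0 (hx0le _ (htJ k)) (hlam k) hKclosed (hx' k) 0
  have hTx0 : ∀ k, T (t k) (x k) - x0 ∈ K := fun k =>
    map_sub_anchor_mem hKadd (hTmono _ (htJ k)) hx0 (hx0le _ (htJ k)) (hxC k) (hx0x k)
  have hTC : ∀ k, T (t k) (x k) ∈ C := fun k => hTself _ (htJ k) _ (hxC k)
  have hdiff : ∀ k, T (t k) (x k) - x k = lam k • (T (t k) (x k) - x0) := by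
    intro k
    nth_rewrite 2 [← hfix k]
    unfold anchoredMap
    module
  have hxT : ∀ k, T (t k) (x k) - x k ∈ K := by
    intro k
    rw [hdiff]
    exact hKcone _ (hlam k).1.le _ (hTx0 k)
  have hsucc : ∀ k, x (k + 1) - x k ∈ K := by
    intro k
    refine hKclosed.mem_of_tendsto ((hx' (k + 1)).sub (hx' k)) (Eventually.of_forall fun n => ?_)
    induction n with
    | zero => simpa using hzero
    | succ n ih =>
      have hz := hiter k n
      have hzF := hiterF k n
      have hw := hiter (k + 1) n
      simp only [Function.iterate_succ_apply'] at ih ⊢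
      set z := (anchoredMap (T (t k)) (lam k) x0)^[n] x0
      set w := (anchoredMap (T (t (k + 1))) (lam (k + 1)) x0)^[n] x0
      have h1 : T (t (k + 1)) w - T (t (k + 1)) z ∈ K :=
        hTmono _ (htJ _) _ hz.1 _ hw.1 ih
      have h2 : T (t (k + 1)) z - T (t k) z ∈ K := by
        rw [htrec, two_mul, hTsemi _ (htJ k) _ (htJ k) _ hz.1]
        exact hTmono _ (htJ k) _ hz.1 _ (hTself _ (htJ k) _ hz.1) hzF
      have h3 : T (t k) z - x0 ∈ K := map_sub_anchor_mem hKadd (hTmono _ (htJ k)) hx0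
        (hx0le _ (htJ k)) hz.1 hz.2.1
      have h := hKadd _ (hKcone (1 - lam (k + 1)) (sub_pos.2 (hlam (k + 1)).2).le _
        (hKadd _ h1 _ h2)) _ (hKcone (lam k - lam (k + 1))
          (sub_pos.2 (hlamanti (Nat.lt_succ_self k))).le _ h3)
      convert h using 1
      unfold anchoredMap
      module
  have hmono : ∀ k m, k ≤ m → x m - x k ∈ K := by
    intro k m hkm
    induction m, hkm using Nat.le_induction with
    | base => simpa using hzero
    | succ m _ ih => simpa using hKadd _ (hsucc m) _ ih
  obtain ⟨D, hD⟩ : ∃ D, ∀ a ∈ C, ∀ b ∈ C, ‖a - b‖ ≤ D := by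
    obtain ⟨D, hD⟩ := Metric.isBounded_iff.1 hCbdd
    exact ⟨D, fun a ha b hb => by simpa [dist_eq_norm] using hD ha hb⟩
  have hres : Tendsto (fun k => ‖T (t k) (x k) - x k‖) atTop (𝓝 0) := by
    refine squeeze_zero (g := fun k => lam k * D) (fun _ => norm_nonneg _) (fun k => ?_)
      (by simpa using hlam0.mul_const D)
    rw [hdiff, norm_smul, Real.norm_of_nonneg (hlam k).1.le]
    exact mul_le_mul_of_nonneg_left (hD _ (hTC k) _ hx0) (hlam k).1.le
  have hasym : ∀ h ∈ J, Tendsto (fun k => ‖x k - T h (x k)‖) atTop (𝓝 0) := by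
    intro h hh
    have h1 : Tendsto (fun k => ‖T (t k) (x k) - T h (T (t k) (x k))‖) atTop (𝓝 0) := by
      rw [Metric.tendsto_nhds]
      intro ε hε
      obtain ⟨M, hM⟩ := hUAR h hh ε hε
      filter_upwards [htlim.eventually_ge_atTop M] with k hk
      simpa using hM _ (htJ k) hk _ (hxC k)
    refine squeeze_zero (fun _ => norm_nonneg _) (fun k => ?_)
      (by simpa using (hres.add h1).add hres)
    have h2 := hnon h hh _ (hxC k) _ (hTC k) (hxT k)
    calc ‖x k - T h (x k)‖
        = ‖-(T (t k) (x k) - x k) + (T (t k) (x k) - T h (T (t k) (x k)))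
            + -(T h (x k) - T h (T (t k) (x k)))‖ := by congr 1; abel
      _ ≤ ‖T (t k) (x k) - x k‖ + ‖T (t k) (x k) - T h (T (t k) (x k))‖
            + ‖T h (x k) - T h (T (t k) (x k))‖ := by
          refine (norm_add₃_le).trans ?_
          rw [norm_neg, norm_neg]
      _ ≤ _ := by rw [norm_sub_rev (x k)] at h2; gcongr
  have hkey : ∀ k, ∀ q ∈ C, (∀ u ∈ J, T u q = q) → q - x k ∈ K →
      ‖x k - q‖ ^ 2 ≤ ⟪x0 - q, x k - q⟫ := fun k q hq hqfix hle =>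
    norm_sq_sub_le_inner_of_anchored (hlam k).1 (hfix k) (hqfix _ (htJ k)) (hlam k).2
      (hnon _ (htJ k) _ (hxC k) _ hq hle)
  have hultra : ∀ U : Ultrafilter ℕ, (U : Filter ℕ) ≤ atTop → ∃ y ∈ C, (∀ u ∈ J, T u y = y) ∧
      (∀ k, y - x k ∈ K) ∧ Tendsto x U (𝓝 y) := by
    intro U hU
    obtain ⟨R, hR⟩ := hCbdd.exists_norm_le
    obtain ⟨y, hy⟩ := exists_weak_limit_of_norm_le U fun k => hR _ (hxC k)
    have hyC : y ∈ C := hCclosed.mem_of_weak_limit hy hCconvex (Eventually.of_forall hxC)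
    have hyK : ∀ k, y - x k ∈ K := by
      intro k
      have hcl : IsClosed ((fun z => z - x k) ⁻¹' K) :=
        hKclosed.preimage (continuous_id.sub continuous_const)
      have hcv : Convex ℝ ((fun z => z - x k) ⁻¹' K) := by
        simpa only [sub_eq_add_neg] using hKconvex.translate_preimage_left (-x k)
      exact hcl.mem_of_weak_limit hy hcv (hU ((eventually_ge_atTop k).mono (hmono k)))
    have hyfix : ∀ u ∈ J, T u y = y := fun u hu =>
      map_eq_of_weak_limit hy (fun k => hD _ (hxC k) _ hyC)
        (fun k => hnon u hu _ (hxC k) _ hyC (hyK k)) ((hasym u hu).mono_left hU)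
    refine ⟨y, hyC, hyfix, hyK, ?_⟩
    have hin : Tendsto (fun k => ⟪x0 - y, x k - y⟫) U (𝓝 0) :=
      tendsto_inner_sub_of_weak_limit hy _
    have hsq : Tendsto (fun k => ‖x k - y‖ ^ 2) U (𝓝 0) :=
      squeeze_zero (fun _ => sq_nonneg _) (fun k => hkey k y hyC hyfix (hyK k)) hin
    rw [tendsto_iff_norm_sub_tendsto_zero]
    simpa using hsq.sqrt
  obtain ⟨y, hyC, hyfix, hyK, hyU⟩ := hultra (Ultrafilter.of atTop) (Ultrafilter.of_le atTop)
  have hlim : Tendsto x atTop (𝓝 y) := by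
    refine (tendsto_iff_ultrafilter x atTop (𝓝 y)).2 fun U hU => ?_
    obtain ⟨w, -, -, hwK, hwU⟩ := hultra U hU
    have h1 : w - y ∈ K :=
      hKclosed.mem_of_tendsto (hyU.const_sub w) (Eventually.of_forall hwK)
    have h2 : y - w ∈ K :=
      hKclosed.mem_of_tendsto (hwU.const_sub y) (Eventually.of_forall hyK)
    have h3 : w - y ∈ K ∩ (-K) := ⟨h1, by simpa using h2⟩
    rw [hKpointed, Set.mem_singleton_iff, sub_eq_zero] at h3
    exact h3 ▸ hwU
  refine ⟨y, hyC, hyfix, hlim, ?_, fun q hq hqfix ki hki hle => ?_⟩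
  · simpa using hKadd _ (hyK 0) _ (hx0x 0)
  · have hsub := hlim.comp hki.tendsto_atTop
    have h : ‖y - q‖ ^ 2 ≤ ⟪x0 - q, y - q⟫ :=
      le_of_tendsto_of_tendsto' ((hsub.sub_const q).norm.pow 2)
        (tendsto_const_nhds.inner (hsub.sub_const q)) fun i => hkey (ki i) q hq hqfix (hle i)
    have h1 : ⟪x0 - q, y - q⟫ = ⟪x0 - y, y - q⟫ + ‖y - q‖ ^ 2 := by
      rw [← real_inner_self_eq_norm_sq, ← inner_add_left, sub_add_sub_cancel]
    have h2 : ‖x0 - q‖ ^ 2 = ‖x0 - y‖ ^ 2 + 2 * ⟪x0 - y, y - q⟫ + ‖y - q‖ ^ 2 := by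
      rw [← sub_add_sub_cancel x0 y q, norm_add_sq_real]
    exact abs_le_of_sq_le_sq' (by nlinarith [sq_nonneg ‖y - q‖]) (norm_nonneg _) |>.2
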